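/- Fix real numbers δv > 0, 0 < δz < 2 and an integer N ≥ 2, and let X be the (N−1)×(N−1) tridiagonal Toeplitz matrix with diagonal c₂ = 5/(6δv), subdiagonal c₁ = (2+δz)/(24δv) and superdiagonal c₃ = (2−δz)/(24δv). Then every (real) eigenvalue λ of the symmetric positive definite matrix Z = X·Xᵀ satisfies λ ≥ (60 + δz²)/(144·δv²); in particular λ > 5/(12·δv²). -/

import Mathlib

open scoped Matrix

/-- Tridiagonal Toeplitz matrix of size `n × n` with diagonal value `a`,
subdiagonal value `b` and superdiagonal value `d`. -/
def tridiag (n : ℕ) (b a d : ℝ) : Matrix (Fin n) (Fin n) ℝ :=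
  Matrix.of fun q q' : Fin n =>
    if (q : ℤ) = (q' : ℤ) then a
    else if (q : ℤ) = (q' : ℤ) + 1 then b
    else if (q : ℤ) + 1 = (q' : ℤ) then d
    else 0

/-- The matrix `X` of the fully discrete Crank–Nicolson compact scheme. -/
noncomputable def Xmat (N : ℕ) (δv δz : ℝ) : Matrix (Fin (N - 1)) (Fin (N - 1)) ℝ :=
  tridiag (N - 1) ((2 + δz) / (24 * δv)) (5 / (6 * δv)) ((2 - δz) / (24 * δv))

/-- The vector `v` padded by a zero on the left and zeros on the right. -/
def zeroPad {n : ℕ} (v : Fin n → ℝ) : ℕ → ℝ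
  | 0 => 0
  | i + 1 => if h : i < n then v ⟨i, h⟩ else 0

lemma zeroPad_succ {n : ℕ} (v : Fin n → ℝ) (i : Fin n) : zeroPad v (i + 1) = v i := by
  simp [zeroPad]

lemma zeroPad_succ_of_le {n : ℕ} (v : Fin n → ℝ) {i : ℕ} (h : n ≤ i) :
    zeroPad v (i + 1) = 0 := by
  simp [zeroPad, h]

lemma tridiag_transpose_mulVec {n : ℕ} (b a d : ℝ) (v : Fin n → ℝ) (i : Fin n) :
    ((tridiag n b a d)ᵀ *ᵥ v) i =
      a * zeroPad v (i + 1) + d * zeroPad v i + b * zeroPad v (i + 2) := by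
  have hsum : ((tridiag n b a d)ᵀ *ᵥ v) i = ∑ j ∈ Finset.range n,
      ((if j = (i : ℕ) then a * zeroPad v (j + 1) else 0)
        + (if j + 1 = (i : ℕ) then d * zeroPad v (j + 1) else 0)
        + (if j = (i : ℕ) + 1 then b * zeroPad v (j + 1) else 0)) := by
    rw [Finset.sum_range, Matrix.mulVec, dotProduct]
    refine Finset.sum_congr rfl fun j _ => ?_
    simp only [tridiag, Matrix.transpose_apply, Matrix.of_apply, zeroPad_succ]
    split_ifs <;> first | omega | simp
  rw [hsum, Finset.sum_add_distrib, Finset.sum_add_distrib]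
  congr 1
  · congr 1
    · simp
    · obtain ⟨i, hi⟩ := i
      cases i with
      | zero => simp [zeroPad]
      | succ k => simp [Nat.lt_of_succ_lt hi]
  · rw [Finset.sum_ite_eq']
    split_ifs with h
    · rfl
    · rw [zeroPad_succ_of_le v (by simpa using h), mul_zero]

lemma sq_tridiagonal_stencil_ge {a b d : ℝ} (ha : 0 ≤ a) (hb : 0 ≤ b) (hd : 0 ≤ d)
    (x p r : ℝ) :
    (a ^ 2 - a * (b + d)) * x ^ 2 - d * (a + b - d) * p ^ 2 - b * (a + d - b) * r ^ 2
      ≤ (a * x + d * p + b * r) ^ 2 := by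
  nlinarith [mul_nonneg (mul_nonneg ha hd) (sq_nonneg (x + p)),
    mul_nonneg (mul_nonneg ha hb) (sq_nonneg (x + r)),
    mul_nonneg (mul_nonneg hb hd) (sq_nonneg (p + r))]

lemma tridiag_transpose_mulVec_sq_ge {n : ℕ} {b a d : ℝ} (hb : 0 ≤ b) (hd : 0 ≤ d)
    (hbd : b + d ≤ a) (v : Fin n → ℝ) :
    (a ^ 2 - 2 * a * (b + d) + (b - d) ^ 2) * (v ⬝ᵥ v) ≤
      ((tridiag n b a d)ᵀ *ᵥ v) ⬝ᵥ ((tridiag n b a d)ᵀ *ᵥ v) := by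
  set w := zeroPad v with hw
  have hv : v ⬝ᵥ v = ∑ i ∈ Finset.range n, w (i + 1) ^ 2 := by
    rw [Finset.sum_range]
    exact Finset.sum_congr rfl fun i _ => by rw [hw, zeroPad_succ, sq]
  have hleft : ∑ i ∈ Finset.range n, w i ^ 2 ≤ v ⬝ᵥ v := by
    have h := Finset.sum_range_succ (fun i => w i ^ 2) n
    rw [Finset.sum_range_succ', ← hv] at h
    have h0 : w 0 = 0 := rfl
    rw [h0] at h
    nlinarith [sq_nonneg (w n)]
  have hright : ∑ i ∈ Finset.range n, w (i + 2) ^ 2 ≤ v ⬝ᵥ v := by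
    have h := Finset.sum_range_succ (fun i => w (i + 1) ^ 2) n
    rw [Finset.sum_range_succ', ← hv] at h
    have h0 : w (n + 1) = 0 := zeroPad_succ_of_le v le_rfl
    rw [h0] at h
    nlinarith [sq_nonneg (w (0 + 1))]
  have hX : ((tridiag n b a d)ᵀ *ᵥ v) ⬝ᵥ ((tridiag n b a d)ᵀ *ᵥ v) =
      ∑ i ∈ Finset.range n, (a * w (i + 1) + d * w i + b * w (i + 2)) ^ 2 := by
    rw [Finset.sum_range]
    exact Finset.sum_congr rfl fun i _ => by rw [tridiag_transpose_mulVec, sq]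
  have hsum := Finset.sum_le_sum fun i (_ : i ∈ Finset.range n) =>
    sq_tridiagonal_stencil_ge (by linarith : 0 ≤ a) hb hd (w (i + 1)) (w i) (w (i + 2))
  rw [← hX, Finset.sum_sub_distrib, Finset.sum_sub_distrib, ← Finset.mul_sum, ← Finset.mul_sum,
    ← Finset.mul_sum, ← hv] at hsum
  have hl := mul_le_mul_of_nonneg_left hleft (mul_nonneg hd (by linarith : 0 ≤ a + b - d))
  have hr := mul_le_mul_of_nonneg_left hright (mul_nonneg hb (by linarith : 0 ≤ a + d - b))
  linarith

lemma le_of_mem_spectrum_tridiag_mul_transpose {n : ℕ} {b a d : ℝ} (hb : 0 ≤ b) (hd : 0 ≤ d)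
    (hbd : b + d ≤ a) {lam : ℝ}
    (h : lam ∈ spectrum ℝ (tridiag n b a d * (tridiag n b a d)ᵀ)) :
    a ^ 2 - 2 * a * (b + d) + (b - d) ^ 2 ≤ lam := by
  rw [← Matrix.spectrum_toLin', ← Module.End.hasEigenvalue_iff_mem_spectrum] at h
  obtain ⟨v, hv⟩ := h.exists_hasEigenvector
  have hZ := hv.apply_eq_smul
  rw [Matrix.toLin'_apply] at hZ
  have hpos : 0 < v ⬝ᵥ v :=
    lt_of_le_of_ne (Finset.sum_nonneg fun i _ => mul_self_nonneg (v i))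
      fun h0 => hv.2 (dotProduct_self_eq_zero.mp h0.symm)
  refine le_of_mul_le_mul_right ?_ hpos
  have hquad : ((tridiag n b a d)ᵀ *ᵥ v) ⬝ᵥ ((tridiag n b a d)ᵀ *ᵥ v) = lam * (v ⬝ᵥ v) := by
    rw [← smul_eq_mul, ← dotProduct_smul, ← hZ, ← Matrix.mulVec_mulVec,
      Matrix.dotProduct_mulVec v, ← Matrix.mulVec_transpose]
  rw [← hquad]
  exact tridiag_transpose_mulVec_sq_ge hb hd hbd v

/-- every (real) eigenvalue `λ` of `Z = X Xᵀ` satisfies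
`λ ≥ (60 + δz²)/(144 δv²)`, in particular `λ > 5/(12 δv²)`. -/
theorem stmt10 (δv δz : ℝ) (hδv : 0 < δv) (hδz : 0 < δz) (hδz2 : δz < 2)
    (N : ℕ) (hN : 2 ≤ N) :
    ∀ lam : ℝ, lam ∈ spectrum ℝ (Xmat N δv δz * (Xmat N δv δz)ᵀ) →
      (60 + δz ^ 2) / (144 * δv ^ 2) ≤ lam ∧ 5 / (12 * δv ^ 2) < lam := by
  intro lam hlam
  have hbound : (60 + δz ^ 2) / (144 * δv ^ 2) ≤ lam := by
    have h := le_of_mem_spectrum_tridiag_mul_transpose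
      (div_nonneg (by linarith) (by positivity)) (div_nonneg (by linarith) (by positivity))
      (by rw [← add_div, div_le_div_iff₀ (by positivity) (by positivity)]; nlinarith) hlam
    convert h using 1
    field_simp
    ring
  refine ⟨hbound, lt_of_lt_of_le ?_ hbound⟩
  rw [div_lt_div_iff₀ (by positivity) (by positivity)]
  have : 0 < δv ^ 2 * δz ^ 2 := by positivity
  nlinarith
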